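/- Let n > d ≥ 1 and let S be an n × n complex matrix. Then the following are equivalent: (a) there exists an equiangular tight frame Φ = (φ_1,…,φ_n) for ℂ^d, with α = √((n−d)/(d(n−1))) > 0, whose Gram matrix satisfies (⟨φ_k,φ_j⟩)_{j,k} = I + α·S; (b) S is Hermitian, all diagonal entries of S are zero, all off-diagonal entries of S have modulus one, S has exactly two distinct eigenvalues, and the larger eigenvalue of S has multiplicity d. -/

import Mathlib

open scoped ComplexInnerProductSpace

noncomputable section

/-- `(φ_1, …, φ_n)` is an equiangular tight frame (ETF) for `ℂ^d`. -/
def IsETF (d n : ℕ) (φ : Fin n → EuclideanSpace ℂ (Fin d)) : Prop :=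
  (∀ x : EuclideanSpace ℂ (Fin d), x = ((d : ℂ) / (n : ℂ)) • ∑ j, ⟪φ j, x⟫ • φ j) ∧
  (∀ j, ‖φ j‖ = 1) ∧
  (∃ α : ℝ, 0 ≤ α ∧ ∀ j k, j ≠ k → ‖⟪φ j, φ k⟫‖ = α)

open Matrix in
lemma spec_aux {n : ℕ} {S : Matrix (Fin n) (Fin n) ℂ} (hS : S.IsHermitian) :
    ∃ U : Matrix (Fin n) (Fin n) ℂ, star U * U = 1 ∧ U * star U = 1 ∧
      S = U * diagonal (fun i => (hS.eigenvalues i : ℂ)) * star U := by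
  refine ⟨hS.eigenvectorUnitary, Unitary.coe_star_mul_self _, Unitary.coe_mul_star_self _, ?_⟩
  have h := hS.spectral_theorem
  rw [Unitary.conjStarAlgAut_apply] at h
  exact h

lemma trace_aux {n : ℕ} {S : Matrix (Fin n) (Fin n) ℂ} (hS : S.IsHermitian)
    (h0 : ∀ j, S j j = 0) (μ₁ μ₂ : ℝ)
    (h : ∀ i, hS.eigenvalues i = μ₁ ∨ hS.eigenvalues i = μ₂) :
    ((Finset.univ.filter fun i => hS.eigenvalues i = μ₁).card : ℝ) * (μ₁ - μ₂) + n * μ₂ = 0 := by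
  have h1 := hS.trace_eq_sum_eigenvalues
  have h2 : S.trace = 0 := by simp [Matrix.trace, h0]
  rw [h2] at h1
  have h3 : ∑ i, hS.eigenvalues i = 0 := by
    have h1' : ((∑ i, hS.eigenvalues i : ℝ) : ℂ) = 0 := by
      rw [Complex.ofReal_sum]; exact h1.symm
    exact_mod_cast h1'
  have h4 : ∀ i, hS.eigenvalues i = (if hS.eigenvalues i = μ₁ then (μ₁ - μ₂) else 0) + μ₂ := by
    intro i
    split_ifs with hi
    · rw [hi]; ring
    · rcases h i with h' | h'
      · exact absurd h' hi
      · rw [h']; ring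
  rw [Finset.sum_congr rfl (fun i _ => h4 i), Finset.sum_add_distrib, ← Finset.sum_filter] at h3
  simp only [Finset.sum_const, nsmul_eq_mul, Finset.card_univ, Fintype.card_fin] at h3
  exact h3

open Matrix in
lemma eig_aux {n : ℕ} {S : Matrix (Fin n) (Fin n) ℂ} (hS : S.IsHermitian) (a c : ℝ)
    (h : (1 + (a : ℂ) • S) * (1 + (a : ℂ) • S) = (c : ℂ) • (1 + (a : ℂ) • S)) (i : Fin n) :
    (1 + a * hS.eigenvalues i) * (1 + a * hS.eigenvalues i) = c * (1 + a * hS.eigenvalues i) := by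
  obtain ⟨U, hU, hU', hSU⟩ := spec_aux hS
  set D : Matrix (Fin n) (Fin n) ℂ := diagonal (fun i => (hS.eigenvalues i : ℂ)) with hD
  set G := 1 + (a : ℂ) • S with hG
  have e1 : 1 + (a : ℂ) • D = star U * G * U := by
    have : star U * S * U = D := by
      rw [hSU]
      calc star U * (U * D * star U) * U = (star U * U) * D * (star U * U) := by
            simp only [Matrix.mul_assoc]
        _ = D := by rw [hU]; simp
    rw [hG, Matrix.mul_add, Matrix.add_mul, Matrix.mul_one, hU, Matrix.mul_smul,
      Matrix.smul_mul, this]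
  have e2 : (1 + (a : ℂ) • D) * (1 + (a : ℂ) • D) = (c : ℂ) • (1 + (a : ℂ) • D) := by
    rw [e1]
    calc star U * G * U * (star U * G * U) = star U * (G * (U * star U) * G) * U := by
          simp only [Matrix.mul_assoc]
      _ = _ := by rw [hU', Matrix.mul_one, h, Matrix.mul_smul, Matrix.smul_mul]
  have e3 : (1 + (a : ℂ) • D) = diagonal (fun i => 1 + (a : ℂ) * (hS.eigenvalues i : ℂ)) := by
    ext j k
    by_cases hjk : j = k
    · subst hjk; simp [hD]
    · simp [hD, hjk]
  rw [e3, diagonal_mul_diagonal] at e2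
  have e4 := congrFun (congrFun e2 i) i
  simp only [diagonal_apply_eq, Matrix.smul_apply, smul_eq_mul] at e4
  exact_mod_cast e4

/-- From ETF to signature matrix. -/
lemma forward_aux {d n : ℕ} (hd : 1 ≤ d) (hdn : d < n)
    (S : Matrix (Fin n) (Fin n) ℂ) (a : ℝ) (ha : 0 < a)
    (ha2 : a ^ 2 * (d * ((n : ℝ) - 1)) = n - d)
    (φ : Fin n → EuclideanSpace ℂ (Fin d)) (hφ : IsETF d n φ)
    (hG : ∀ j k : Fin n, ⟪φ j, φ k⟫ = (if j = k then 1 else 0) + (a : ℂ) * S j k) :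
    (∃ hS : S.IsHermitian,
      (∀ j, S j j = 0) ∧
      (∀ j k, j ≠ k → ‖S j k‖ = 1) ∧
      ∃ μ₁ μ₂ : ℝ, μ₂ < μ₁ ∧
        (∀ i, hS.eigenvalues i = μ₁ ∨ hS.eigenvalues i = μ₂) ∧
        (∃ i, hS.eigenvalues i = μ₁) ∧ (∃ i, hS.eigenvalues i = μ₂) ∧
        (Finset.univ.filter fun i => hS.eigenvalues i = μ₁).card = d) := by
  obtain ⟨hfr, hnorm, β, hβ, heq⟩ := hφ
  have haC : (a : ℂ) ≠ 0 := by exact_mod_cast ha.ne'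
  have hdR : (0 : ℝ) < d := by exact_mod_cast hd
  have hnR : (d : ℝ) < n := by exact_mod_cast hdn
  have hn1 : (1 : ℝ) < n := by exact_mod_cast (by omega : 1 < n)
  have hS : S.IsHermitian := by
    ext j k
    rw [Matrix.conjTranspose_apply]
    have h1 := hG j k
    have h2 := hG k j
    rw [← inner_conj_symm, h2] at h1
    by_cases hjk : j = k
    · subst hjk; simpa [haC] using h1
    · simpa [haC, hjk, Ne.symm hjk] using h1
  have h0 : ∀ j, S j j = 0 := by
    intro j
    have h1 := hG j j
    rw [inner_self_eq_norm_sq_to_K, hnorm j] at h1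
    simpa [haC] using h1
  have hmat : (1 + (a : ℂ) • S) = Matrix.of (fun j k => ⟪φ j, φ k⟫) := by
    ext j k
    simp [hG, Matrix.one_apply]
  have hdC : (d : ℂ) ≠ 0 := by exact_mod_cast hdR.ne'
  have hnC : (n : ℂ) ≠ 0 := by exact_mod_cast (by linarith : (n : ℝ) ≠ 0)
  have hsum : ∀ j k, ∑ i, ⟪φ j, φ i⟫ * ⟪φ i, φ k⟫ = ((n : ℂ) / d) * ⟪φ j, φ k⟫ := by
    intro j k
    have h1 := congrArg (fun x => ⟪φ j, x⟫) (hfr (φ k))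
    simp only [inner_smul_right, inner_sum] at h1
    rw [h1]
    field_simp
    exact Finset.sum_congr rfl fun i _ => mul_comm _ _
  have hGG : (1 + (a : ℂ) • S) * (1 + (a : ℂ) • S)
      = (((n : ℝ) / d : ℝ) : ℂ) • (1 + (a : ℂ) • S) := by
    rw [hmat]
    ext j k
    simp [Matrix.mul_apply, hsum]
  have hβa : β = a := by
    have j : Fin n := ⟨0, by omega⟩
    have h1 := hsum j j
    have h2 : ∀ i, ⟪φ j, φ i⟫ * ⟪φ i, φ j⟫ = (((if i = j then 1 - β ^ 2 else 0) + β ^ 2 : ℝ) : ℂ) := by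
      intro i
      rw [← inner_conj_symm (φ i) (φ j), Complex.mul_conj, Complex.normSq_eq_norm_sq]
      split_ifs with hi
      · subst hi
        rw [inner_self_eq_norm_sq_to_K, hnorm]; simp
      · rw [heq j i (Ne.symm hi)]; simp
    rw [Finset.sum_congr rfl (fun i _ => h2 i), inner_self_eq_norm_sq_to_K, hnorm,
      ← Complex.ofReal_sum] at h1
    have h3 : ∑ i : Fin n, ((if i = j then 1 - β ^ 2 else 0) + β ^ 2 : ℝ) = (n : ℝ) / d := by
      apply Complex.ofReal_injective
      rw [h1]; simp
    rw [Finset.sum_add_distrib] at h3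
    simp at h3
    field_simp at h3
    have h4 : (β ^ 2 - a ^ 2) * (d * ((n : ℝ) - 1)) = 0 := by linarith
    have h5 : (d * ((n : ℝ) - 1)) ≠ 0 := by
      have : (0:ℝ) < n - 1 := by linarith
      positivity
    have h6 : β ^ 2 = a ^ 2 := by
      have := (mul_eq_zero.mp h4).resolve_right h5
      linarith
    exact (sq_eq_sq₀ hβ ha.le).mp h6
  have h1 : ∀ j k, j ≠ k → ‖S j k‖ = 1 := by
    intro j k hjk
    have h1 := heq j k hjk
    rw [hG, hβa, if_neg hjk, zero_add, norm_mul, Complex.norm_real, Real.norm_of_nonneg ha.le] at h1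
    exact mul_left_cancel₀ ha.ne' (by rw [h1, mul_one])
  have hdich : ∀ i, hS.eigenvalues i = ((n : ℝ) / d - 1) / a ∨ hS.eigenvalues i = - 1 / a := by
    intro i
    have h2 := eig_aux hS a ((n : ℝ) / d) hGG i
    have h3 : ((1 + a * hS.eigenvalues i) - (n : ℝ) / d) * (1 + a * hS.eigenvalues i) = 0 := by
      linarith
    rcases mul_eq_zero.mp h3 with h | h
    · left; rw [eq_div_iff ha.ne']; linarith
    · right; rw [eq_div_iff ha.ne']; linarith
  have htr := trace_aux hS h0 _ _ hdich
  have hcard : (Finset.univ.filter fun i => hS.eigenvalues i = ((n : ℝ) / d - 1) / a).card = d := by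
    have hnd : (n : ℝ) ≠ 0 := by linarith
    have : ((Finset.univ.filter fun i => hS.eigenvalues i = ((n : ℝ) / d - 1) / a).card : ℝ) = d := by
      generalize ((Finset.univ.filter fun i => hS.eigenvalues i = ((n : ℝ) / d - 1) / a).card : ℝ) = m at htr
      field_simp at htr
      have h5 : (n : ℝ) * (m - d) = 0 := by linarith
      have := (mul_eq_zero.mp h5).resolve_left hnd
      linarith
    exact_mod_cast this
  refine ⟨hS, h0, h1, ((n : ℝ) / d - 1) / a, - 1 / a, ?_, hdich, ?_, ?_, hcard⟩
  · apply div_lt_div_of_pos_right _ ha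
    have : 0 < (n : ℝ) / d := by positivity
    linarith
  · have : 0 < (Finset.univ.filter fun i => hS.eigenvalues i = ((n : ℝ) / d - 1) / a).card := by omega
    obtain ⟨i, hi⟩ := Finset.card_pos.mp this
    exact ⟨i, (Finset.mem_filter.mp hi).2⟩
  · by_contra hne
    push Not at hne
    have : (Finset.univ.filter fun i => hS.eigenvalues i = ((n : ℝ) / d - 1) / a) = Finset.univ :=
      Finset.filter_true_of_mem fun i _ => (hdich i).resolve_right (hne i)
    rw [this] at hcard
    simp at hcard
    omega

/-- From signature matrix to ETF. -/
lemma backward_aux {d n : ℕ} (hd : 1 ≤ d) (hdn : d < n)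
    (S : Matrix (Fin n) (Fin n) ℂ) (a : ℝ) (ha : 0 < a)
    (ha2 : a ^ 2 * (d * ((n : ℝ) - 1)) = n - d)
    (hS : S.IsHermitian) (h0 : ∀ j, S j j = 0) (h1 : ∀ j k, j ≠ k → ‖S j k‖ = 1)
    (μ₁ μ₂ : ℝ) (hlt : μ₂ < μ₁)
    (hdich : ∀ i, hS.eigenvalues i = μ₁ ∨ hS.eigenvalues i = μ₂)
    (hcard : (Finset.univ.filter fun i => hS.eigenvalues i = μ₁).card = d) :
    ∃ φ : Fin n → EuclideanSpace ℂ (Fin d), IsETF d n φ ∧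
      ∀ j k : Fin n, ⟪φ j, φ k⟫ = (if j = k then 1 else 0) + (a : ℂ) * S j k := by
  have hdR : (0 : ℝ) < d := by exact_mod_cast hd
  have hnR : (d : ℝ) < n := by exact_mod_cast hdn
  have hn1 : (1 : ℝ) < n := by exact_mod_cast (by omega : 1 < n)
  have hn0 : (0 : ℝ) < n := by linarith
  have hdC : (d : ℂ) ≠ 0 := by exact_mod_cast hdR.ne'
  have hnC : (n : ℂ) ≠ 0 := by exact_mod_cast hn0.ne'
  have htr := trace_aux hS h0 _ _ hdich
  rw [hcard] at htr
  obtain ⟨U, hU, hU', hSU⟩ := spec_aux hS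
  -- the product of the two eigenvalues
  have hprod : (n : ℝ) - 1 + μ₁ * μ₂ = 0 := by
    have hSS : S * S = ((μ₁ + μ₂ : ℝ) : ℂ) • S - ((μ₁ * μ₂ : ℝ) : ℂ) • 1 := by
      set D : Matrix (Fin n) (Fin n) ℂ :=
        Matrix.diagonal (fun i => (hS.eigenvalues i : ℂ)) with hD
      have hDD : D * D = ((μ₁ + μ₂ : ℝ) : ℂ) • D - ((μ₁ * μ₂ : ℝ) : ℂ) • 1 := by
        rw [hD, Matrix.diagonal_mul_diagonal]
        ext j k
        by_cases hjk : j = k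
        · subst hjk
          rcases hdich j with h | h <;> simp [h] <;> ring
        · simp [hjk]
      rw [hSU]
      calc U * D * star U * (U * D * star U) = U * (D * (star U * U) * D) * star U := by
            simp only [Matrix.mul_assoc]
        _ = _ := by
            rw [hU, Matrix.mul_one, hDD, Matrix.mul_sub, Matrix.sub_mul, Matrix.mul_smul,
              Matrix.smul_mul, Matrix.mul_smul, Matrix.smul_mul, Matrix.mul_one, hU']
    have j : Fin n := ⟨0, by omega⟩
    have h2 := congrFun (congrFun hSS j) j
    rw [Matrix.mul_apply] at h2
    have h3 : ∀ i, S j i * S i j = (((if i = j then -1 else 0) + 1 : ℝ) : ℂ) := by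
      intro i
      split_ifs with hi
      · subst hi; simp [h0]
      · rw [← hS.apply i j, ← starRingEnd_apply, Complex.mul_conj, Complex.normSq_eq_norm_sq, h1 j i (Ne.symm hi)]
        simp
    rw [Finset.sum_congr rfl (fun i _ => h3 i), ← Complex.ofReal_sum] at h2
    have h4 : ∑ i : Fin n, ((if i = j then -1 else 0) + 1 : ℝ) = - (μ₁ * μ₂) := by
      apply Complex.ofReal_injective
      rw [h2]; simp [h0]
    rw [Finset.sum_add_distrib] at h4
    simp at h4
    linarith
  have hμ₁ : 0 < μ₁ := by
    by_contra hc
    push Not at hc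
    nlinarith
  have haμ₂ : a * μ₂ = -1 := by
    have e1 : (n - d : ℝ) * ((a * μ₂) ^ 2 - 1) = 0 := by
      have : (n - d : ℝ) * μ₂ ^ 2 = d * (n - 1) := by
        have : (n - d : ℝ) * μ₂ = - d * μ₁ := by linarith
        calc (n - d : ℝ) * μ₂ ^ 2 = ((n - d : ℝ) * μ₂) * μ₂ := by ring
          _ = _ := by rw [this]; linear_combination (-d : ℝ) * hprod
      linear_combination a ^ 2 * this + ha2
    have e2 := (mul_eq_zero.mp e1).resolve_left (by linarith)
    have e3 : (a * μ₂ - 1) * (a * μ₂ + 1) = 0 := by linarith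
    have hμ₂ : μ₂ < 0 := by nlinarith
    have : a * μ₂ < 0 := mul_neg_of_pos_of_neg ha hμ₂
    have := (mul_eq_zero.mp e3).resolve_left (by linarith)
    linarith
  have haμ₁ : a * (μ₁ - μ₂) = n / d := by
    rw [eq_div_iff hdR.ne']
    linear_combination a * htr - n * haμ₂
  -- the frame
  set F := Finset.univ.filter fun i => hS.eigenvalues i = μ₁ with hF
  let e : Fin d ≃ F := (F.equivFinOfCardEq hcard).symm
  let s : ℝ := Real.sqrt (n / d)
  have hs : (s : ℂ) * s = n / d := by
    have : s * s = n / d := Real.mul_self_sqrt (by positivity)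
    have h := congrArg (fun t : ℝ => (t : ℂ)) this
    push_cast at h
    exact h
  have hss : star (s : ℂ) = s := Complex.conj_ofReal s
  let φ : Fin n → EuclideanSpace ℂ (Fin d) :=
    fun j => WithLp.toLp 2 (fun b => (s : ℂ) * star (U j (e b)))
  have hinner : ∀ j k : Fin n, ⟪φ j, φ k⟫ = (if j = k then 1 else 0) + (a : ℂ) * S j k := by
    intro j k
    have e1 : ⟪φ j, φ k⟫ = ((n : ℂ) / d) * ∑ i ∈ F, U j i * star (U k i) := by
      rw [PiLp.inner_apply, Finset.mul_sum, ← Finset.sum_coe_sort F, ← e.sum_comp]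
      refine Finset.sum_congr rfl fun b _ => ?_
      simp only [φ, RCLike.inner_apply, map_mul, hss, starRingEnd_apply, star_star]
      rw [← hs]; ring
    have e2 : S j k = ∑ i, (hS.eigenvalues i : ℂ) * (U j i * star (U k i)) := by
      conv_lhs => rw [hSU]
      rw [Matrix.mul_apply]
      refine Finset.sum_congr rfl fun i _ => ?_
      rw [Matrix.mul_diagonal, Matrix.star_apply]; ring
    have e3 : (if j = k then 1 else 0 : ℂ) = ∑ i, U j i * star (U k i) := by
      have := congrFun (congrFun hU' j) k
      rw [Matrix.mul_apply, Matrix.one_apply] at this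
      rw [← this]; rfl
    rw [e1, e2, e3, hF, Finset.sum_filter, Finset.mul_sum, Finset.mul_sum, ← Finset.sum_add_distrib]
    refine Finset.sum_congr rfl fun i _ => ?_
    have c2 : (a : ℂ) * μ₂ = -1 := by exact_mod_cast haμ₂
    have c1 : (a : ℂ) * (μ₁ - μ₂) = n / d := by
      have h := congrArg (fun t : ℝ => (t : ℂ)) haμ₁
      push_cast at h
      exact h
    split_ifs with hi
    · rw [hi, ← c1]; linear_combination (- (U j i * star (U k i))) * c2
    · rw [(hdich i).resolve_left hi]; linear_combination (- (U j i * star (U k i))) * c2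
  refine ⟨φ, ⟨?_, ?_, a, ha.le, ?_⟩, hinner⟩
  · intro x
    ext b
    have orth : ∀ c : Fin d, ∑ j, U j (e c) * star (U j (e b)) = if c = b then 1 else 0 := by
      intro c
      have := congrFun (congrFun hU (e b)) (e c)
      rw [Matrix.mul_apply, Matrix.one_apply] at this
      have h5 : ((e b : Fin n) = e c) ↔ c = b := by
        rw [← Subtype.ext_iff, e.injective.eq_iff, eq_comm]
      simp only [h5] at this
      rw [← this]
      exact Finset.sum_congr rfl fun i _ => mul_comm _ _
    have e1 : (∑ j, ⟪φ j, x⟫ • φ j) b = ((n : ℂ) / d) * x b := by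
      have : (∑ j, ⟪φ j, x⟫ • φ j) b = ∑ j, ⟪φ j, x⟫ * ((s : ℂ) * star (U j (e b))) := by
        simp [φ]
      rw [this]
      have : ∀ j, ⟪φ j, x⟫ * ((s : ℂ) * star (U j (e b)))
          = ∑ c, ((n : ℂ) / d) * x c * (U j (e c) * star (U j (e b))) := by
        intro j
        rw [PiLp.inner_apply, Finset.sum_mul]
        refine Finset.sum_congr rfl fun c _ => ?_
        simp only [φ, RCLike.inner_apply, map_mul, hss, starRingEnd_apply,
          star_star]
        rw [← hs]; ring
      rw [Finset.sum_congr rfl (fun j _ => this j), Finset.sum_comm]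
      simp_rw [← Finset.mul_sum, orth]
      simp
    rw [PiLp.smul_apply, e1, smul_eq_mul]
    field_simp
  · intro j
    have h2 := hinner j j
    rw [h0, inner_self_eq_norm_sq_to_K] at h2
    have h3 : ‖φ j‖ ^ 2 = 1 := by
      apply Complex.ofReal_injective
      simpa using h2
    exact (pow_eq_one_iff_of_nonneg (norm_nonneg _) two_ne_zero).mp h3
  · intro j k hjk
    rw [hinner, if_neg hjk, zero_add, norm_mul, h1 j k hjk, Complex.norm_real,
      Real.norm_of_nonneg ha.le, mul_one]

/-- Characterization of signature matrices of equiangular tight frames: `S` is the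
signature matrix of an ETF of `n` vectors in `ℂ^d` (i.e. the Gram matrix is `I + αS`
with `α = √((n−d)/(d(n−1)))`) if and only if `S` is Hermitian with zero diagonal and
unimodular off-diagonal entries, has exactly two distinct eigenvalues, and its larger
eigenvalue has multiplicity `d`. -/
theorem signature_matrix_characterization {d n : ℕ} (hd : 1 ≤ d) (hdn : d < n)
    (S : Matrix (Fin n) (Fin n) ℂ) :
    (∃ φ : Fin n → EuclideanSpace ℂ (Fin d), IsETF d n φ ∧
      ∀ j k : Fin n, ⟪φ j, φ k⟫ =
        (if j = k then 1 else 0) +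
          ((Real.sqrt (((n : ℝ) - d) / (d * ((n : ℝ) - 1))) : ℝ) : ℂ) * S j k) ↔
    (∃ hS : S.IsHermitian,
      (∀ j, S j j = 0) ∧
      (∀ j k, j ≠ k → ‖S j k‖ = 1) ∧
      ∃ μ₁ μ₂ : ℝ, μ₂ < μ₁ ∧
        (∀ i, hS.eigenvalues i = μ₁ ∨ hS.eigenvalues i = μ₂) ∧
        (∃ i, hS.eigenvalues i = μ₁) ∧ (∃ i, hS.eigenvalues i = μ₂) ∧
        (Finset.univ.filter fun i => hS.eigenvalues i = μ₁).card = d) := by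
  have hdR : (0 : ℝ) < d := by exact_mod_cast hd
  have hnR : (0 : ℝ) < (n : ℝ) - d := sub_pos.mpr (by exact_mod_cast hdn)
  have hn1 : (0 : ℝ) < (n : ℝ) - 1 := sub_pos.mpr (by exact_mod_cast (by omega : 1 < n))
  have hpos : 0 < ((n : ℝ) - d) / (d * ((n : ℝ) - 1)) := by positivity
  have ha := Real.sqrt_pos.mpr hpos
  have ha2 : Real.sqrt (((n : ℝ) - d) / (d * ((n : ℝ) - 1))) ^ 2 * (d * ((n : ℝ) - 1)) = n - d := by
    rw [Real.sq_sqrt hpos.le]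
    field_simp
  constructor
  · rintro ⟨φ, hφ, hG⟩
    exact forward_aux hd hdn S _ ha ha2 φ hφ hG
  · rintro ⟨hS, h0, h1, μ₁, μ₂, hlt, hdich, -, -, hcard⟩
    exact backward_aux hd hdn S _ ha ha2 hS h0 h1 μ₁ μ₂ hlt hdich hcard
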